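/- Let x, y be pyramidal tours with step-backs in the complete digraph on {1,…,n} with x ≠ y whose vertices x^v and y^v of PSB(n) are nonadjacent, and let z be a pyramidal tour with step-backs different from x and y, every arc of which is an arc of x or of y, such that z^v appears with a positive coefficient in some convex combination of the vertices {w^v : w ∈ PSBT_n, w ≠ x, w ≠ y} that equals a point of the open segment joining x^v and y^v. Let i be the smallest city at which z switches from x to y and j the smallest city at which z switches from y to x, with 2 ≤ i < j ≤ n−1, and let i_a be the first city after the block formed by (x, y) at i (i_a = i+1 for a single block, i_a = i+2 for a double block at (i, i+1)) and j_b the last city before the block formed at j (j_b = j−1 for a single block, j_b = j−2 for a double block at (j−1, j)). Then the direction bits of x and y coincide on the central part: x^{0,1}_k = y^{0,1}_k for all i_a ≤ k ≤ j_b. -/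

import Mathlib

/-!
Formalization of pyramidal tours with step-backs (Nikolaev, arXiv:1901.09361).

Cities are `Fin n` (city `c` of the paper, `1 ≤ c ≤ n`, is the element of
`Fin n` with value `c - 1`; so "city 1" is `0` and "city n" is `topCity n`).
A Hamiltonian tour in the complete digraph is a permutation of the cities that
is a single cycle through all of them; the arc leaving city `i` in the tour
`τ` is `(i, τ i)`.
-/

open Equiv

namespace PSBPaper

variable {n : ℕ}

/-- The largest city (city `n` of the paper). -/
def topCity (n : ℕ) [NeZero n] : Fin n := ⟨n - 1, Nat.sub_lt (NeZero.pos n) one_pos⟩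

/-- A Hamiltonian tour: a permutation forming a single directed cycle visiting
every city exactly once. -/
def IsHamTour (τ : Equiv.Perm (Fin n)) : Prop :=
  τ.IsCycle ∧ ∀ i, τ i ≠ i

/-- City `i` is a peak of `τ`: both its predecessor and successor are smaller. -/
def IsPeak (τ : Equiv.Perm (Fin n)) (i : Fin n) : Prop :=
  τ⁻¹ i < i ∧ τ i < i

/-- City `i` is a step-back peak of `τ`. -/
def IsStepBackPeak (τ : Equiv.Perm (Fin n)) (i : Fin n) : Prop :=
  (τ⁻¹ i < i ∧ (τ i).val + 1 = i.val ∧ i < τ (τ i)) ∨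
  (i < τ⁻¹ (τ⁻¹ i) ∧ (τ⁻¹ i).val + 1 = i.val ∧ τ i < i)

/-- A proper peak: a peak that is not a step-back peak. -/
def IsProperPeak (τ : Equiv.Perm (Fin n)) (i : Fin n) : Prop :=
  IsPeak τ i ∧ ¬ IsStepBackPeak τ i

/-- A pyramidal tour with step-backs: a Hamiltonian tour whose only proper peak
is the city `n`. -/
def IsPSBT [NeZero n] (τ : Equiv.Perm (Fin n)) : Prop :=
  IsHamTour τ ∧ ∀ i, IsProperPeak τ i ↔ i = topCity n

/-- Characteristic vector of a tour: entry `1` on arcs of the tour, `0` elsewhere. -/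
def charVec (τ : Equiv.Perm (Fin n)) : Fin n × Fin n → ℝ :=
  fun e => if τ e.1 = e.2 then 1 else 0

/-- The vertices of `PSB(n)` distinct from `x^v` and `y^v`. -/
def otherVerts [NeZero n] (x y : Equiv.Perm (Fin n)) : Set (Fin n × Fin n → ℝ) :=
  {v | ∃ z : Equiv.Perm (Fin n), IsPSBT z ∧ z ≠ x ∧ z ≠ y ∧ v = charVec z}

/-- Nonadjacency of the vertices `x^v` and `y^v` in the 1-skeleton of `PSB(n)`:
some point of the open segment joining them lies in the convex hull of the
remaining vertices of the polytope. -/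
def Nonadjacent [NeZero n] (x y : Equiv.Perm (Fin n)) : Prop :=
  ∃ p ∈ openSegment ℝ (charVec x) (charVec y), p ∈ convexHull ℝ (otherVerts x y)

/-- City `i` is visited by `τ` in ascending order: it is reached from city `1`
no later than the first visit to city `n` (direction bit `x^{0,1}_i = 1`). -/
def AscCity [NeZero n] (τ : Equiv.Perm (Fin n)) (i : Fin n) : Prop :=
  ∃ k : ℕ, (τ ^ k) 0 = i ∧ ∀ m < k, (τ ^ m) 0 ≠ topCity n

/-- The arc of `τ` leaving city `i` belongs to the ascending path (from city 1
to city n) of `τ`. -/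
def AscArc [NeZero n] (τ : Equiv.Perm (Fin n)) (i : Fin n) : Prop :=
  AscCity τ i ∧ i ≠ topCity n

/-- Ascending step-back of `τ` at `(i, i+1)`: `τ` enters `i+1` from a city
smaller than `i`, goes `i+1 → i`, then `i →` a city larger than `i+1`. -/
def AscSB (τ : Equiv.Perm (Fin n)) (i j : Fin n) : Prop :=
  j.val = i.val + 1 ∧ τ⁻¹ j < i ∧ τ j = i ∧ j < τ i

/-- Descending step-back of `τ` at `(i, i+1)`: `τ` enters `i` from a city
larger than `i+1`, goes `i → i+1`, then `i+1 →` a city smaller than `i`. -/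
def DescSB (τ : Equiv.Perm (Fin n)) (i j : Fin n) : Prop :=
  j.val = i.val + 1 ∧ j < τ⁻¹ i ∧ τ i = j ∧ τ j < i

/-- City `i` is involved in some step-back of `τ`. -/
def InSB (τ : Equiv.Perm (Fin n)) (i : Fin n) : Prop :=
  ∃ j, AscSB τ i j ∨ AscSB τ j i ∨ DescSB τ i j ∨ DescSB τ j i

/-- `i` is the lower city of an ascending step-back of `τ`. -/
def AscSBLower (τ : Equiv.Perm (Fin n)) (i : Fin n) : Prop := ∃ j, AscSB τ i j

/-- `j` is the upper city of an ascending step-back of `τ`. -/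
def AscSBUpper (τ : Equiv.Perm (Fin n)) (j : Fin n) : Prop := ∃ i, AscSB τ i j

/-- `i` is the lower city of a descending step-back of `τ`. -/
def DescSBLower (τ : Equiv.Perm (Fin n)) (i : Fin n) : Prop := ∃ j, DescSB τ i j

/-- `j` is the upper city of a descending step-back of `τ`. -/
def DescSBUpper (τ : Equiv.Perm (Fin n)) (j : Fin n) : Prop := ∃ i, DescSB τ i j

/-- Single `U`-block of the pair `(x, y)` at city `i`: both tours visit `i` in
the same order and neither has a step-back involving `i` (`U₁₁` and `U₀₀`). -/
def SingleU [NeZero n] (x y : Equiv.Perm (Fin n)) (i : Fin n) : Prop :=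
  ((AscCity x i ∧ AscCity y i) ∨ (¬AscCity x i ∧ ¬AscCity y i)) ∧
    ¬InSB x i ∧ ¬InSB y i

/-- Double `U`-block at `(i, i+1)`: both tours have an ascending step-back at
`(i,i+1)` (`U₁₁₁₁`), or both have a descending one (`U₀₀₀₀`). -/
def DoubleU (x y : Equiv.Perm (Fin n)) (i j : Fin n) : Prop :=
  (AscSB x i j ∧ AscSB y i j) ∨ (DescSB x i j ∧ DescSB y i j)

/-- `L`-blocks `L₁₁₁₀`, `L₁₀₁₁`, `L₀₀₀₁`, `L₀₁₀₀` at `(i, i+1)`. -/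
def LBlock [NeZero n] (x y : Equiv.Perm (Fin n)) (i j : Fin n) : Prop :=
  (AscSB x i j ∧ AscCity y i ∧ ¬InSB y i ∧ ¬AscCity y j) ∨
  (AscSB y i j ∧ AscCity x i ∧ ¬InSB x i ∧ ¬AscCity x j) ∨
  (DescSB x i j ∧ ¬AscCity y i ∧ ¬InSB y i ∧ AscCity y j) ∨
  (DescSB y i j ∧ ¬AscCity x i ∧ ¬InSB x i ∧ AscCity x j)

/-- `R`-blocks `R₁₁₀₁`, `R₀₁₁₁`, `R₀₀₁₀`, `R₁₀₀₀` at `(i, i+1)`. -/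
def RBlock [NeZero n] (x y : Equiv.Perm (Fin n)) (i j : Fin n) : Prop :=
  (AscSB x i j ∧ ¬AscCity y i ∧ AscCity y j ∧ ¬InSB y j) ∨
  (AscSB y i j ∧ ¬AscCity x i ∧ AscCity x j ∧ ¬InSB x j) ∨
  (DescSB x i j ∧ AscCity y i ∧ ¬AscCity y j ∧ ¬InSB y j) ∨
  (DescSB y i j ∧ AscCity x i ∧ ¬AscCity x j ∧ ¬InSB x j)

/-- The encodings `x^{0,1,sb}` and `y^{0,1,sb}` agree at the city `k`:
same direction bit and the same step-back markers. -/
def EncAgree [NeZero n] (x y : Equiv.Perm (Fin n)) (k : Fin n) : Prop :=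
  (AscCity x k ↔ AscCity y k) ∧
  (AscSBLower x k ↔ AscSBLower y k) ∧ (AscSBUpper x k ↔ AscSBUpper y k) ∧
  (DescSBLower x k ↔ DescSBLower y k) ∧ (DescSBUpper x k ↔ DescSBUpper y k)

/-- The ascending step-back data of `x` and `y` agree at `k`. -/
def AscDataAgree (x y : Equiv.Perm (Fin n)) (k : Fin n) : Prop :=
  (AscSBLower x k ↔ AscSBLower y k) ∧ (AscSBUpper x k ↔ AscSBUpper y k)

/-- The descending step-back data of `x` and `y` agree at `k`. -/
def DescDataAgree (x y : Equiv.Perm (Fin n)) (k : Fin n) : Prop :=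
  (DescSBLower x k ↔ DescSBLower y k) ∧ (DescSBUpper x k ↔ DescSBUpper y k)

/-- `x` and `y` differ in the left part: the encodings differ at some
coordinate (city number) in `[2, i_a − 1]`.  City numbers are `k.val + 1`. -/
def DiffLeft [NeZero n] (x y : Equiv.Perm (Fin n)) (ia : ℕ) : Prop :=
  ∃ k : Fin n, 2 ≤ k.val + 1 ∧ k.val + 1 ≤ ia - 1 ∧ ¬EncAgree x y k

/-- `x` and `y` differ in the right part: the encodings differ at some
coordinate (city number) in `[j_b + 1, n − 1]`. -/
def DiffRight [NeZero n] (x y : Equiv.Perm (Fin n)) (jb : ℕ) : Prop :=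
  ∃ k : Fin n, jb + 1 ≤ k.val + 1 ∧ k.val + 1 ≤ n - 1 ∧ ¬EncAgree x y k

/-- `x` and `y` differ in the central part in ascending order. -/
def DiffCentralAsc [NeZero n] (x y : Equiv.Perm (Fin n)) (ia jb : ℕ) : Prop :=
  ∃ k : Fin n, ia ≤ k.val + 1 ∧ k.val + 1 ≤ jb ∧
    AscCity x k ∧ AscCity y k ∧ ¬AscDataAgree x y k

/-- `x` and `y` differ in the central part in descending order. -/
def DiffCentralDesc [NeZero n] (x y : Equiv.Perm (Fin n)) (ia jb : ℕ) : Prop :=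
  ∃ k : Fin n, ia ≤ k.val + 1 ∧ k.val + 1 ≤ jb ∧
    ¬AscCity x k ∧ ¬AscCity y k ∧ ¬DescDataAgree x y k

/-- `b` is an admissible direction bit of `τ` at city `i`: at the cities `1`
and `n` either bit is allowed, elsewhere it is the actual direction bit. -/
def DirBitOK [NeZero n] (τ : Equiv.Perm (Fin n)) (i : Fin n) (b : Bool) : Prop :=
  i.val = 0 ∨ i.val = n - 1 ∨ (b = true ↔ AscCity τ i)

/-- Left block with first city after the block having city number `ia` and
admissible direction bit `bi` of `x` at the block city: either the city `1`
(`ia = 2`), a single `U`-block at `i` (`ia = i + 1` in city numbers, i.e.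
`i.val + 2`), or a double `U`- or `L`-block at `(i, i+1)` (`ia = i + 2`). -/
def LeftBlockSpec [NeZero n] (x y : Equiv.Perm (Fin n)) (ia : ℕ) (bi : Bool) : Prop :=
  ia = 2 ∨
  (∃ i : Fin n, SingleU x y i ∧ ia = i.val + 2 ∧ DirBitOK x i bi) ∨
  (∃ i j : Fin n, (DoubleU x y i j ∨ LBlock x y i j) ∧ ia = i.val + 3 ∧ DirBitOK x i bi)

/-- Right block with last city before the block having city number `jb`:
either the city `n` (`jb = n − 1`), a single `U`-block at `j` (`jb = j − 1`
in city numbers, i.e. `j.val`), or a double `U`- or `R`-block at `(j−1, j)`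
(`jb = j − 2`, i.e. `j.val − 1`). -/
def RightBlockSpec [NeZero n] (x y : Equiv.Perm (Fin n)) (jb : ℕ) (bj : Bool) : Prop :=
  jb = n - 1 ∨
  (∃ j : Fin n, SingleU x y j ∧ jb = j.val ∧ DirBitOK x j bj) ∨
  (∃ i j : Fin n, (DoubleU x y i j ∨ RBlock x y i j) ∧ jb = j.val - 1 ∧ DirBitOK x j bj)

/-- The direction bits of `x` and `y` coincide on the central part
(city numbers from `ia` to `jb`). -/
def CentralDirEq [NeZero n] (x y : Equiv.Perm (Fin n)) (ia jb : ℕ) : Prop :=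
  ∀ k : Fin n, ia ≤ k.val + 1 → k.val + 1 ≤ jb → (AscCity x k ↔ AscCity y k)

/-- The four case conditions of the adjacency criterion, depending on the
(admissible) direction bits of `x` at the left and right block cities. -/
def CaseCond [NeZero n] (x y : Equiv.Perm (Fin n)) (ia jb : ℕ) : Bool → Bool → Prop
  | true, true =>
      DiffCentralAsc x y ia jb ∧
        (DiffLeft x y ia ∨ DiffCentralDesc x y ia jb ∨ DiffRight x y jb)
  | false, false =>
      DiffCentralDesc x y ia jb ∧
        (DiffLeft x y ia ∨ DiffCentralAsc x y ia jb ∨ DiffRight x y jb)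
  | true, false =>
      (DiffCentralAsc x y ia jb ∨ DiffRight x y jb) ∧
        (DiffCentralDesc x y ia jb ∨ DiffLeft x y ia)
  | false, true =>
      (DiffCentralDesc x y ia jb ∨ DiffRight x y jb) ∧
        (DiffCentralAsc x y ia jb ∨ DiffLeft x y ia)

/-- The block conditions for the pair `(x, y)`. -/
def BlockConditions [NeZero n] (x y : Equiv.Perm (Fin n)) : Prop :=
  ∃ (ia jb : ℕ) (bi bj : Bool),
    LeftBlockSpec x y ia bi ∧ RightBlockSpec x y jb bj ∧
    CentralDirEq x y ia jb ∧ CaseCond x y ia jb bi bj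

/-- `z` switches from `x` to `y` at city `i`: the arc of `z` entering `i` is an
arc of `x`, the arc of `z` leaving `i` is an arc of `y`, and at least one of
these two arcs belongs to exactly one of the tours `x`, `y`. -/
def SwitchXtoY (x y z : Equiv.Perm (Fin n)) (i : Fin n) : Prop :=
  x (z⁻¹ i) = i ∧ y i = z i ∧ (y (z⁻¹ i) ≠ i ∨ x i ≠ z i)

/-- `z` switches from `y` to `x` at city `i`. -/
def SwitchYtoX (x y z : Equiv.Perm (Fin n)) (i : Fin n) : Prop :=
  y (z⁻¹ i) = i ∧ x i = z i ∧ (x (z⁻¹ i) ≠ i ∨ y i ≠ z i)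

/-- `z^v` appears with a positive coefficient in some convex combination of the
vertices `{w^v : w ∈ PSBT_n, w ≠ x, w ≠ y}` that equals a point of the open
segment joining `x^v` and `y^v`. -/
def PositiveWitness [NeZero n] (x y z : Equiv.Perm (Fin n)) : Prop :=
  ∃ β : Equiv.Perm (Fin n) → ℝ,
    (∀ w, 0 ≤ β w) ∧
    (∀ w, β w ≠ 0 → IsPSBT w ∧ w ≠ x ∧ w ≠ y) ∧
    (∑ w : Equiv.Perm (Fin n), β w) = 1 ∧
    (∑ w : Equiv.Perm (Fin n), β w • charVec w) ∈
      openSegment ℝ (charVec x) (charVec y) ∧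
    0 < β z

end PSBPaper

namespace PSBPaper

section Inverse

variable {n : ℕ} {τ : Equiv.Perm (Fin n)}

theorem perm_apply_inv_apply {α : Type*} (e : Equiv.Perm α) (c : α) : e (e⁻¹ c) = c :=
  e.apply_symm_apply c

theorem perm_inv_apply_apply {α : Type*} (e : Equiv.Perm α) (c : α) : e⁻¹ (e c) = c :=
  e.symm_apply_apply c

theorem ascSB_inv_iff {i j : Fin n} : AscSB τ⁻¹ i j ↔ DescSB τ i j := by
  simp only [AscSB, DescSB, inv_inv, Perm.inv_eq_iff_eq]
  constructor
  · rintro ⟨h1, h2, h3, h4⟩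
    exact ⟨h1, h4, h3.symm, h2⟩
  · rintro ⟨h1, h2, h3, h4⟩
    exact ⟨h1, h4, h3.symm, h2⟩

/-- The tour passes through the city upwards or downwards, i.e. the city is neither a peak
nor a valley. -/
def Passes (τ : Equiv.Perm (Fin n)) (c : Fin n) : Prop :=
  (τ⁻¹ c < c ∧ c < τ c) ∨ (τ c < c ∧ c < τ⁻¹ c)

theorem passes_inv_iff {c : Fin n} : Passes τ⁻¹ c ↔ Passes τ c := by
  rw [Passes, Passes, inv_inv, or_comm]

end Inverse

section Paths

variable {n : ℕ} [NeZero n] {τ : Equiv.Perm (Fin n)}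

theorem IsPSBT.inv (h : IsPSBT τ) : IsPSBT τ⁻¹ := by
  obtain ⟨⟨hc, hne⟩, hp⟩ := h
  refine ⟨⟨hc.inv, fun i hi => hne i ?_⟩, fun i => ?_⟩
  · rw [Perm.inv_eq_iff_eq] at hi
    exact hi.symm
  · rw [← hp i]
    simp only [IsProperPeak, IsPeak, IsStepBackPeak, inv_inv]
    tauto

theorem apply_pow_zero (τ : Equiv.Perm (Fin n)) (m : ℕ) :
    τ ((τ ^ m) 0) = (τ ^ (m + 1)) 0 := by
  rw [pow_succ', Perm.mul_apply]

theorem inv_apply_pow_succ_zero (τ : Equiv.Perm (Fin n)) (m : ℕ) :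
    τ⁻¹ ((τ ^ (m + 1)) 0) = (τ ^ m) 0 := by
  rw [Perm.inv_eq_iff_eq, apply_pow_zero]

/-- The city reached after `m` steps from city `0` is larger than all the earlier ones. -/
def RecordAt (τ : Equiv.Perm (Fin n)) (m : ℕ) : Prop :=
  ∀ l < m, (τ ^ l) 0 < (τ ^ m) 0

/-- The city reached after `m + 1` steps from city `0` is the lower city of an ascending
step-back, and all the cities before the step-back are smaller. -/
def StepBackAt (τ : Equiv.Perm (Fin n)) (m : ℕ) : Prop :=
  ((τ ^ m) 0).val = ((τ ^ (m + 1)) 0).val + 1 ∧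
    (∀ l < m, (τ ^ l) 0 < (τ ^ (m + 1)) 0) ∧ (τ ^ m) 0 < (τ ^ (m + 2)) 0

theorem StepBackAt.recordAt {m : ℕ} (h : StepBackAt τ m) : RecordAt τ (m + 2) := by
  obtain ⟨h1, h2, h3⟩ := h
  intro l hl
  rcases Nat.lt_or_ge l m with hlm | hlm
  · have := h2 l hlm
    omega
  · rcases Nat.eq_or_lt_of_le hlm with rfl | hlm
    · exact h3
    · obtain rfl : l = m + 1 := by omega
      omega

theorem RecordAt.step (h : IsPSBT τ) {m : ℕ} (hm : RecordAt τ m)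
    (htop : (τ ^ m) 0 ≠ topCity n) : RecordAt τ (m + 1) ∨ StepBackAt τ m := by
  have hne : (τ ^ (m + 1)) 0 ≠ (τ ^ m) 0 := by
    rw [← apply_pow_zero]
    exact h.1.2 _
  rcases lt_or_gt_of_ne hne with hlt | hgt
  · right
    rcases m with _ | m
    · exact absurd hlt (by simp)
    have hprev : τ⁻¹ ((τ ^ (m + 1)) 0) < (τ ^ (m + 1)) 0 := by
      rw [inv_apply_pow_succ_zero]
      exact hm m (by omega)
    have hsb : IsStepBackPeak τ ((τ ^ (m + 1)) 0) := by
      by_contra hns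
      exact htop ((h.2 _).1 ⟨⟨hprev, by rwa [apply_pow_zero]⟩, hns⟩)
    rcases hsb with ⟨-, h2, h3⟩ | ⟨h1, h2, -⟩
    · rw [apply_pow_zero] at h2 h3
      rw [apply_pow_zero] at h3
      refine ⟨h2.symm, fun l hl => ?_, h3⟩
      have h4 := hm l hl
      have h5 : (τ ^ l) 0 ≠ (τ ^ (m + 1 + 1)) 0 := by
        intro heq
        have h6 : (τ ^ (l + 1)) 0 = (τ ^ (m + 1 + 1 + 1)) 0 := by
          rw [← apply_pow_zero, heq, apply_pow_zero]
        have h7 : (τ ^ (l + 1)) 0 ≤ (τ ^ (m + 1)) 0 := by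
          rcases Nat.eq_or_lt_of_le (Nat.succ_le_of_lt hl) with heq' | hlt'
          · rw [show l + 1 = m + 1 from heq']
          · exact (hm _ hlt').le
        rw [h6] at h7
        exact absurd h3 (not_lt.2 h7)
      have h8 : ((τ ^ l) 0).val ≠ ((τ ^ (m + 1 + 1)) 0).val := fun hv => h5 (Fin.ext hv)
      omega
    · rw [inv_apply_pow_succ_zero] at h1 h2
      rcases m with _ | m
      · exfalso
        have h3 : ((τ ^ (0 + 1 + 1)) 0).val = ((τ ^ 0) (0 : Fin n)).val := by
          have : ((τ ^ 0) (0 : Fin n)).val = 0 := by simp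
          omega
        have h4 : τ⁻¹ ((τ ^ 0) (0 : Fin n)) = (τ ^ (0 + 1)) 0 := by
          rw [← Fin.ext h3, inv_apply_pow_succ_zero]
        rw [h4] at h1
        exact lt_irrefl _ h1
      · rw [inv_apply_pow_succ_zero] at h1
        exact absurd h1 (not_lt.2 (hm m (by omega)).le)
  · left
    intro l hl
    rcases Nat.eq_or_lt_of_le (Nat.le_of_lt_succ hl) with rfl | hl
    · exact hgt
    · exact (hm l hl).trans hgt

theorem recordAt_or_stepBackAt (h : IsPSBT τ) :
    ∀ m, (∀ l < m, (τ ^ l) 0 ≠ topCity n) →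
      RecordAt τ m ∨ ∃ p, m = p + 1 ∧ StepBackAt τ p := by
  intro m
  induction m with
  | zero => exact fun _ => Or.inl fun l hl => absurd hl (by omega)
  | succ m ih =>
    intro hm
    rcases ih fun l hl => hm l (by omega) with hr | ⟨p, rfl, hp⟩
    · exact (hr.step h (hm m (by omega))).imp_right fun hs => ⟨m, rfl, hs⟩
    · exact Or.inl hp.recordAt

/-- The ascending path is increasing, except that the city directly before the lower city
of a step-back is its upper city. -/
theorem ascPath_lt_or_stepBack (h : IsPSBT τ) {m l : ℕ}
    (hm : ∀ l < m, (τ ^ l) 0 ≠ topCity n) (hl : l < m) :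
    (τ ^ l) 0 < (τ ^ m) 0 ∨ (((τ ^ l) 0).val = ((τ ^ m) 0).val + 1 ∧
      τ ((τ ^ l) 0) = (τ ^ m) 0 ∧ τ⁻¹ ((τ ^ l) 0) < (τ ^ m) 0 ∧
      (τ ^ l) 0 < τ ((τ ^ m) 0)) := by
  rcases recordAt_or_stepBackAt h m hm with hr | ⟨p, rfl, h1, h2, h3⟩
  · exact Or.inl (hr l hl)
  · rcases Nat.eq_or_lt_of_le (Nat.le_of_lt_succ hl) with rfl | hl
    · rcases l with _ | l
      · simp at h1
      · refine Or.inr ⟨h1, apply_pow_zero _ _, ?_, by rwa [apply_pow_zero]⟩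
        rw [inv_apply_pow_succ_zero]
        exact h2 l (by omega)
    · exact Or.inl (h2 l hl)

/-- Behaviour of a tour at an inner city visited in ascending order: it passes upwards
through the city, or makes an ascending step-back there. -/
theorem AscCity.pass_or_stepBack (h : IsPSBT τ) {c : Fin n} (hc : AscCity τ c) (h0 : c ≠ 0)
    (htop : c ≠ topCity n) :
    (τ⁻¹ c < c ∧ c < τ c) ∨ (τ⁻¹ c < τ c ∧ AscSB τ (τ c) c) ∨
      (τ⁻¹ c < τ c ∧ AscSB τ c (τ⁻¹ c)) := by
  obtain ⟨m, rfl, hm⟩ := hc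
  rcases m with _ | m
  · simp at h0
  rcases recordAt_or_stepBackAt h _ hm with hr | ⟨p, hp, h1, h2, h3⟩
  · rcases hr.step h htop with hr' | ⟨h1, h2, h3⟩
    · left
      rw [inv_apply_pow_succ_zero, apply_pow_zero]
      exact ⟨hr m (by omega), hr' _ (by omega)⟩
    · right; left
      refine ⟨?_, ?_, ?_, rfl, ?_⟩
      · rw [inv_apply_pow_succ_zero, apply_pow_zero]
        exact h2 m (by omega)
      · rwa [apply_pow_zero]
      · rw [inv_apply_pow_succ_zero, apply_pow_zero]
        exact h2 m (by omega)
      · rwa [apply_pow_zero, apply_pow_zero]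
  · right; right
    obtain rfl : m = p := by omega
    rw [AscSB, inv_apply_pow_succ_zero, apply_pow_zero]
    refine ⟨h3, h1, ?_, apply_pow_zero _ _, h3⟩
    rcases m with _ | m
    · simp at h1
    · rw [inv_apply_pow_succ_zero]
      exact h2 m (by omega)

theorem AscCity.inv_lt (h : IsPSBT τ) {c : Fin n} (hc : AscCity τ c) (h0 : c ≠ 0)
    (htop : c ≠ topCity n) : τ⁻¹ c < τ c := by
  rcases hc.pass_or_stepBack h h0 htop with h1 | h1 | h1
  · exact h1.1.trans h1.2
  · exact h1.1
  · exact h1.1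

theorem exists_pow_zero_eq (h : IsHamTour τ) (c : Fin n) : ∃ m : ℕ, (τ ^ m) 0 = c :=
  h.1.exists_pow_eq (h.2 0) (h.2 c)

theorem ascCity_or_ascCity_inv (h : IsPSBT τ) (c : Fin n) : AscCity τ c ∨ AscCity τ⁻¹ c := by
  classical
  have hK := exists_pow_zero_eq h.1 (topCity n)
  have hP := exists_pow_zero_eq h.1 c
  have hQ := exists_pow_zero_eq h.inv.1 c
  by_cases hle : Nat.find hP ≤ Nat.find hK
  · exact Or.inl ⟨_, Nat.find_spec hP, fun m hm => Nat.find_min hK (by omega)⟩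
  refine Or.inr ⟨_, Nat.find_spec hQ, fun r hr htop => ?_⟩
  have hK' := Nat.find_spec hK
  have hP' := Nat.find_spec hP
  have hr' : (τ ^ r) (topCity n) = 0 := by
    rw [← htop, inv_pow, perm_apply_inv_apply]
  have hper : (τ ^ (r + Nat.find hK)) 0 = 0 := by
    rw [pow_add, Perm.mul_apply, hK', hr']
  have hlt : Nat.find hP < r + Nat.find hK := by
    by_contra hge
    obtain ⟨d, hd⟩ := Nat.exists_eq_add_of_le (not_lt.1 hge)
    have hpos : 0 < r + Nat.find hK := by
      rcases Nat.eq_zero_or_pos r with rfl | hr0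
      · rcases Nat.eq_zero_or_pos (Nat.find hK) with h0 | h0
        · exfalso
          rw [h0] at hK'
          have h1 : (0 : Fin n) = topCity n := by simpa using hK'
          have h2 := ((h.2 0).2 h1).1.2
          exact absurd h2 (by simp)
        · omega
      · omega
    refine Nat.find_min hP (m := d) (by omega) ?_
    rw [hd, add_comm, pow_add, Perm.mul_apply, hper] at hP'
    exact hP'
  obtain ⟨d, hd⟩ := Nat.exists_eq_add_of_lt hlt
  refine Nat.find_min hQ (m := d + 1) (by omega) ?_
  rw [inv_pow, Perm.inv_eq_iff_eq, ← hP', ← Perm.mul_apply, ← pow_add]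
  rw [show d + 1 + Nat.find hP = r + Nat.find hK by omega, hper]

/-- An inner city is visited in ascending order iff its predecessor is smaller than its
successor. -/
theorem ascCity_iff (h : IsPSBT τ) {c : Fin n} (h0 : c ≠ 0) (htop : c ≠ topCity n) :
    AscCity τ c ↔ τ⁻¹ c < τ c := by
  refine ⟨fun hc => hc.inv_lt h h0 htop, fun hlt => ?_⟩
  refine (ascCity_or_ascCity_inv h c).resolve_right fun hc => ?_
  have := hc.inv_lt h.inv h0 htop
  rw [inv_inv] at this
  exact lt_asymm this hlt

theorem ascCity_inv_iff (h : IsPSBT τ) {c : Fin n} (h0 : c ≠ 0) (htop : c ≠ topCity n) :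
    AscCity τ⁻¹ c ↔ ¬AscCity τ c := by
  refine ⟨fun hc hc' => ?_, (ascCity_or_ascCity_inv h c).resolve_left⟩
  have := hc.inv_lt h.inv h0 htop
  rw [inv_inv] at this
  exact lt_asymm this (hc'.inv_lt h h0 htop)

theorem pass_up_of_not_inSB (h : IsPSBT τ) {c : Fin n} (h0 : c ≠ 0) (htop : c ≠ topCity n)
    (hc : AscCity τ c) (hs : ¬InSB τ c) : τ⁻¹ c < c ∧ c < τ c := by
  rcases hc.pass_or_stepBack h h0 htop with h1 | h1 | h1
  · exact h1
  · exact absurd ⟨_, Or.inr (Or.inl h1.2)⟩ hs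
  · exact absurd ⟨_, Or.inl h1.2⟩ hs

theorem pass_down_of_not_inSB (h : IsPSBT τ) {c : Fin n} (h0 : c ≠ 0) (htop : c ≠ topCity n)
    (hc : ¬AscCity τ c) (hs : ¬InSB τ c) : τ c < c ∧ c < τ⁻¹ c := by
  have := ((ascCity_inv_iff h h0 htop).2 hc).pass_or_stepBack h.inv h0 htop
  rw [ascSB_inv_iff, ascSB_inv_iff, inv_inv] at this
  rcases this with h1 | h1 | h1
  · exact h1
  · exact absurd ⟨_, Or.inr (Or.inr (Or.inr h1.2))⟩ hs
  · exact absurd ⟨_, Or.inr (Or.inr (Or.inl h1.2))⟩ hs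

/-- Cities preceding `k` on the ascending path lie below any level `j > k`, provided that no
step-back joins `k` with `j`. -/
theorem ascPath_lt_level (h : IsPSBT τ) {m l : ℕ} {k j : Fin n} (hk : (τ ^ m) 0 = k)
    (hm : ∀ l < m, (τ ^ l) 0 ≠ topCity n) (hkj : k < j)
    (hj : k.val + 1 = j.val → Passes τ j) (hl : l ≤ m) : (τ ^ l) 0 < j := by
  rcases Nat.eq_or_lt_of_le hl with rfl | hl
  · rwa [hk]
  rcases ascPath_lt_or_stepBack h hm hl with h1 | ⟨h1, h2, h3, -⟩
  · rw [hk] at h1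
    exact h1.trans hkj
  · rw [hk] at h1 h2 h3
    by_contra hge
    have heq : (τ ^ l) 0 = j := Fin.ext (by omega)
    rw [heq] at h1 h2 h3
    rcases hj h1.symm with hp | hp <;> rw [h2] at hp <;> omega

/-- A city `k > i` visited in ascending order is visited after `i`, provided that no
step-back joins `i` with `k`. -/
theorem ascPath_index_lt (h : IsPSBT τ) {a m : ℕ} {k i : Fin n} (hk : (τ ^ m) 0 = k)
    (hi : (τ ^ a) 0 = i) (ha : ∀ l < a, (τ ^ l) 0 ≠ topCity n) (hik : i < k)
    (hpass : i.val + 1 = k.val → Passes τ i) : a < m := by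
  by_contra hge
  rcases Nat.eq_or_lt_of_le (not_lt.1 hge) with heq | hlt
  · rw [← heq, hk] at hi
    exact absurd hik (by simp [hi])
  rcases ascPath_lt_or_stepBack h ha hlt with h1 | ⟨h1, h2, h3, h4⟩
  · rw [hk, hi] at h1
    exact lt_asymm h1 hik
  · rw [hk, hi] at h1 h2 h4
    have h5 : τ⁻¹ i = k := by rw [Perm.inv_eq_iff_eq, h2]
    rcases hpass h1.symm with hp | hp <;> rw [h5] at hp <;> omega

end Paths

section Switching

variable {n : ℕ} {x y z : Equiv.Perm (Fin n)}

theorem follows_y_of_not_switch (harcs : ∀ k, z k = x k ∨ z k = y k) {c : Fin n}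
    (hc : z c = y c) (hs : ¬SwitchYtoX x y z (z c)) : z (z c) = y (z c) := by
  by_contra hne
  refine hs ⟨?_, ((harcs (z c)).resolve_right hne).symm, Or.inr (Ne.symm hne)⟩
  rw [perm_inv_apply_apply, ← hc]

theorem follows_x_of_not_switch (harcs : ∀ k, z k = x k ∨ z k = y k) {c : Fin n}
    (hc : z (z c) = x (z c)) (hs : ¬SwitchYtoX x y z (z c)) : z c = x c := by
  by_contra hne
  have h1 := (harcs c).resolve_left hne
  refine hs ⟨?_, hc.symm, Or.inl ?_⟩
  · rw [perm_inv_apply_apply, ← h1]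
  · rw [perm_inv_apply_apply]
    exact Ne.symm hne

theorem switchYtoX_inv_iff {c : Fin n} :
    SwitchYtoX y⁻¹ x⁻¹ z⁻¹ c ↔ SwitchYtoX x y z c := by
  have h : ∀ u v : Equiv.Perm (Fin n), ∀ d : Fin n, u⁻¹ d = v⁻¹ d ↔ u (v⁻¹ d) = d := by
    intro u v d
    rw [Perm.inv_eq_iff_eq, eq_comm]
  simp only [SwitchYtoX, inv_inv, ne_eq, h, Perm.inv_eq_iff_eq, eq_comm (a := z c)]
  tauto

variable [NeZero n]

theorem central_direction_of_ascending_switch (hx : IsPSBT x) (hy : IsPSBT y) (hz : IsPSBT z)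
    (harcs : ∀ k, z k = x k ∨ z k = y k) {i j k : Fin n}
    (hnsw : ∀ c < j, ¬SwitchYtoX x y z c)
    (hin : x (z⁻¹ i) = i) (hout : y i = z i) (h0i : 0 < i) (hik : i < k) (hkj : k < j)
    (hjtop : j < topCity n) (hzi : AscCity z i) (hyi : AscCity y i)
    (hpy : i.val + 1 = k.val → Passes y i) (hpz : i.val + 1 = k.val → Passes z i)
    (hqx : k.val + 1 = j.val → Passes x j) (hqy : k.val + 1 = j.val → Passes y j)
    (hqz : k.val + 1 = j.val → Passes z j) : AscCity x k ↔ AscCity y k := by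
  have hk0 : k ≠ 0 := (h0i.trans hik).ne'
  have hktop : k ≠ topCity n := (hkj.trans hjtop).ne
  obtain ⟨a, hsa, ha⟩ := hzi
  obtain ⟨b, htb, hb⟩ := hyi
  have ha0 : a ≠ 0 := by
    rintro rfl
    exact h0i.ne (by simpa using hsa)
  -- along `z`, backwards from `i` to the city `0`, the arcs belong to `x`
  have hback : ∀ d, d + 1 ≤ a → z ((z ^ (a - (d + 1))) 0) = x ((z ^ (a - (d + 1))) 0) := by
    intro d
    induction d with
    | zero =>
      intro _
      have h1 : z ((z ^ (a - (0 + 1))) 0) = i := by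
        rw [apply_pow_zero, show a - (0 + 1) + 1 = a by omega, hsa]
      have h2 : z⁻¹ i = (z ^ (a - (0 + 1))) 0 := by rw [Perm.inv_eq_iff_eq, h1]
      rw [h1, ← h2, hin]
    | succ d ih =>
      intro hd
      have h1 : z ((z ^ (a - (d + 1 + 1))) 0) = (z ^ (a - (d + 1))) 0 := by
        rw [apply_pow_zero, show a - (d + 1 + 1) + 1 = a - (d + 1) by omega]
      refine follows_x_of_not_switch harcs ?_ ?_ <;> rw [h1]
      · exact ih (by omega)
      · apply hnsw
        rcases ascPath_lt_or_stepBack hz ha (l := a - (d + 1)) (by omega) with h2 | ⟨h2, -⟩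
        · rw [hsa] at h2
          exact h2.trans (hik.trans hkj)
        · rw [hsa] at h2
          omega
  have hzero : z 0 = x 0 := by
    have := hback (a - 1) (by omega)
    rwa [show a - (a - 1 + 1) = 0 by omega, pow_zero, Perm.one_apply] at this
  -- the reversed paths of `x` and `z` from the city `0` agree below the level `j`
  have hxpath : ∀ m, (∀ l < m, (z⁻¹ ^ l) 0 < j) →
      (z⁻¹ ^ m) 0 = (x⁻¹ ^ m) 0 ∧ z ((z⁻¹ ^ m) 0) = x ((z⁻¹ ^ m) 0) := by
    intro m
    induction m with
    | zero => exact fun _ => ⟨by simp, by simpa using hzero⟩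
    | succ m ih =>
      intro hm
      obtain ⟨h1, h2⟩ := ih fun l hl => hm l (by omega)
      have h3 : z ((z⁻¹ ^ (m + 1)) 0) = (z⁻¹ ^ m) 0 := by
        rw [← apply_pow_zero, perm_apply_inv_apply]
      have h4 : z ((z⁻¹ ^ (m + 1)) 0) = x ((z⁻¹ ^ (m + 1)) 0) := by
        refine follows_x_of_not_switch harcs ?_ ?_ <;> rw [h3]
        · exact h2
        · exact hnsw _ (hm m (by omega))
      refine ⟨?_, h4⟩
      rw [← apply_pow_zero x⁻¹, ← h1, Perm.eq_inv_iff_eq, ← h4, h3]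
  have hxpath' : ∀ m, (∀ l < m, (x⁻¹ ^ l) 0 < j) → ∀ l ≤ m, (z⁻¹ ^ l) 0 = (x⁻¹ ^ l) 0 := by
    intro m hm l
    induction l using Nat.strong_induction_on with
    | _ l ih =>
      intro hl
      refine (hxpath l fun l' hl' => ?_).1
      rw [ih l' hl' (by omega)]
      exact hm l' (by omega)
  -- the paths of `y` and `z` from the city `i` agree below the level `j`
  have hypath : ∀ m, (∀ l < m, (z ^ (a + l)) 0 < j) → (z ^ (a + m)) 0 = (y ^ (b + m)) 0 ∧
      ((z ^ (a + m)) 0 < j → z ((z ^ (a + m)) 0) = y ((z ^ (a + m)) 0)) := by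
    intro m
    induction m with
    | zero =>
      intro _
      rw [add_zero, add_zero, hsa, htb]
      exact ⟨rfl, fun _ => hout.symm⟩
    | succ m ih =>
      intro hm
      obtain ⟨h1, h2⟩ := ih fun l hl => hm l (by omega)
      have h3 := h2 (hm m (by omega))
      rw [← add_assoc, ← add_assoc, ← apply_pow_zero, ← apply_pow_zero]
      exact ⟨by rw [h3, h1], fun hlt => follows_y_of_not_switch harcs h3 (hnsw _ hlt)⟩
  have hypath' : ∀ m, (∀ l < m, (y ^ (b + l)) 0 < j) →
      ∀ l ≤ m, (z ^ (a + l)) 0 = (y ^ (b + l)) 0 := by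
    intro m hm l
    induction l using Nat.strong_induction_on with
    | _ l ih =>
      intro hl
      refine (hypath l fun l' hl' => ?_).1
      rw [ih l' hl' (by omega)]
      exact hm l' (by omega)
  by_cases hzk : AscCity z k
  · obtain ⟨c, hsc, hc⟩ := id hzk
    have hac : a < c := ascPath_index_lt hz hsc hsa ha hik hpz
    have hlev : ∀ l ≤ c, (z ^ l) 0 < j := fun l hl =>
      ascPath_lt_level hz hsc hc hkj hqz hl
    have hasc_y : AscCity y k := by
      have h1 := (hypath (c - a) fun l hl => hlev _ (by omega)).2 (hlev _ (by omega))
      have h2 := (hypath (c - a - 1) fun l hl => hlev _ (by omega)).2 (hlev _ (by omega))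
      have h3 : z ((z ^ (a + (c - a - 1))) 0) = k := by
        rw [apply_pow_zero, show a + (c - a - 1) + 1 = c by omega, hsc]
      rw [show a + (c - a) = c by omega, hsc] at h1
      have h4 : y⁻¹ k = z⁻¹ k := by
        rw [Perm.inv_eq_iff_eq]
        conv_lhs => rw [← h3, h2]
        congr 1
        rw [Perm.eq_inv_iff_eq, h3]
      rw [ascCity_iff hy hk0 hktop, h4, ← h1]
      exact hzk.inv_lt hz hk0 hktop
    have hasc_x : AscCity x k := by
      refine (ascCity_or_ascCity_inv hx k).resolve_right fun hxk => ?_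
      obtain ⟨d, hud, hd⟩ := hxk
      have hlev' : ∀ l ≤ d, (x⁻¹ ^ l) 0 < j := fun l hl =>
        ascPath_lt_level hx.inv hud hd hkj (fun h => passes_inv_iff.2 (hqx h)) hl
      have hag := hxpath' d fun l hl => hlev' l hl.le
      refine (ascCity_inv_iff hz hk0 hktop).1 ⟨d, (hag d le_rfl).trans hud, ?_⟩ hzk
      intro l hl
      rw [hag l hl.le]
      exact hd l hl
    exact iff_of_true hasc_x hasc_y
  · obtain ⟨c, hsc, hc⟩ := (ascCity_inv_iff hz hk0 hktop).2 hzk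
    have hlev : ∀ l ≤ c, (z⁻¹ ^ l) 0 < j := fun l hl =>
      ascPath_lt_level hz.inv hsc hc hkj (fun h => passes_inv_iff.2 (hqz h)) hl
    have hdesc_x : ¬AscCity x k := by
      have h1 := (hxpath c fun l hl => hlev l hl.le)
      have h2 := (hxpath (c + 1) fun l hl => hlev l (by omega))
      rw [← apply_pow_zero, hsc, perm_apply_inv_apply, ← apply_pow_zero x⁻¹, ← h1.1, hsc] at h2
      rw [hsc] at h1
      rw [ascCity_iff hx hk0 hktop, ← h2.1, ← h1.2, ← ascCity_iff hz hk0 hktop]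
      exact hzk
    have hdesc_y : ¬AscCity y k := by
      rintro ⟨d, htd, hd⟩
      have hbd : b < d := ascPath_index_lt hy htd htb hb hik hpy
      have hlev' : ∀ l ≤ d, (y ^ l) 0 < j := fun l hl =>
        ascPath_lt_level hy htd hd hkj hqy hl
      have hag := hypath' (d - b) fun l _ => hlev' _ (by omega)
      refine hzk ⟨a + (d - b), ?_, fun l hl => ?_⟩
      · rw [hag _ le_rfl, show b + (d - b) = d by omega, htd]
      · rcases Nat.lt_or_ge l a with hla | hla
        · exact ha l hla
        · obtain ⟨e, rfl⟩ := Nat.exists_eq_add_of_le hla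
          rw [hag e (by omega)]
          exact ((hlev' _ (by omega)).trans hjtop).ne
    exact iff_of_false hdesc_x hdesc_y

theorem AscCity.ascSB_of_apply_lt {τ : Equiv.Perm (Fin n)} (h : IsPSBT τ) {c : Fin n}
    (hc : AscCity τ c) (h0 : c ≠ 0) (htop : c ≠ topCity n) (hlt : τ c < c) :
    AscSB τ (τ c) c := by
  rcases hc.pass_or_stepBack h h0 htop with h1 | h1 | h1
  · exact absurd h1.2 (lt_asymm hlt)
  · exact h1.2
  · have h2 := h1.2.1
    have h3 := h1.1
    omega

theorem descSB_of_inv_apply_lt {τ : Equiv.Perm (Fin n)} (h : IsPSBT τ) {c : Fin n}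
    (hc : ¬AscCity τ c) (h0 : c ≠ 0) (htop : c ≠ topCity n) (hlt : τ⁻¹ c < c) :
    DescSB τ (τ⁻¹ c) c :=
  ascSB_inv_iff.1 (((ascCity_inv_iff h h0 htop).2 hc).ascSB_of_apply_lt h.inv h0 htop hlt)

theorem AscSB.ascCity {τ : Equiv.Perm (Fin n)} (h : IsPSBT τ) {c d : Fin n} (hs : AscSB τ c d)
    (h0 : c ≠ 0) : AscCity τ c := by
  obtain ⟨h1, h2, h3, h4⟩ := hs
  have h5 : τ⁻¹ c = d := by rw [Perm.inv_eq_iff_eq, h3]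
  have h6 : c ≠ topCity n := by
    rintro rfl
    simp only [topCity] at h1
    omega
  rwa [ascCity_iff h h0 h6, h5]

theorem DescSB.not_ascCity {τ : Equiv.Perm (Fin n)} (h : IsPSBT τ) {c d : Fin n}
    (hs : DescSB τ c d) (h0 : c ≠ 0) : ¬AscCity τ c := by
  obtain ⟨h1, h2, h3, h4⟩ := hs
  have h6 : c ≠ topCity n := by
    rintro rfl
    simp only [topCity] at h1
    omega
  rw [ascCity_iff h h0 h6, h3]
  exact lt_asymm h2

theorem SingleU.symm {c : Fin n} (h : SingleU x y c) : SingleU y x c := by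
  rw [SingleU] at *
  tauto

/-- A tour switching between `x` and `y` at a single block passes through it in the common
direction of `x` and `y`. -/
theorem SingleU.passes (hx : IsPSBT x) (hy : IsPSBT y) {c : Fin n} (h0 : c ≠ 0)
    (htop : c ≠ topCity n) (hu : SingleU x y c) (hin : x (z⁻¹ c) = c) (hout : y c = z c) :
    Passes x c ∧ Passes y c ∧ Passes z c := by
  have hin' : z⁻¹ c = x⁻¹ c := by rw [Perm.eq_inv_iff_eq, hin]
  obtain ⟨hd, hsx, hsy⟩ := hu
  simp only [Passes, hin', ← hout]
  rcases hd with ⟨h1, h2⟩ | ⟨h1, h2⟩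
  · have h3 := pass_up_of_not_inSB hx h0 htop h1 hsx
    have h4 := pass_up_of_not_inSB hy h0 htop h2 hsy
    exact ⟨Or.inl h3, Or.inl h4, Or.inl ⟨h3.1, h4.2⟩⟩
  · have h3 := pass_down_of_not_inSB hx h0 htop h1 hsx
    have h4 := pass_down_of_not_inSB hy h0 htop h2 hsy
    exact ⟨Or.inr h3, Or.inr h4, Or.inr ⟨h4.1, h3.2⟩⟩

/-- Direction of a tour that switches from `x` to `y` at a single block or at the lower city
of a double `U`- or `L`-block. -/
theorem direction_of_left_block (hx : IsPSBT x) (hy : IsPSBT y) (hz : IsPSBT z) {i : Fin n}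
    (h0 : i ≠ 0) (htop : i ≠ topCity n) (hin : x (z⁻¹ i) = i) (hout : y i = z i)
    (hb : SingleU x y i ∨ ∃ i', DoubleU x y i i' ∨ LBlock x y i i') :
    (AscCity z i ∧ AscCity y i) ∨ (¬AscCity z i ∧ ¬AscCity x i) := by
  have hin' : z⁻¹ i = x⁻¹ i := by rw [Perm.eq_inv_iff_eq, hin]
  suffices (x⁻¹ i < y i ∧ AscCity y i) ∨ (y i < x⁻¹ i ∧ ¬AscCity x i) by
    rw [ascCity_iff hz h0 htop, hin', ← hout]
    exact this.imp_right fun h => ⟨lt_asymm h.1, h.2⟩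
  have hup : ∀ {τ : Equiv.Perm (Fin n)} {i' : Fin n}, AscSB τ i i' →
      i'.val = i.val + 1 ∧ τ⁻¹ i = i' ∧ i' < τ i := fun ⟨h1, _, h3, h4⟩ =>
    ⟨h1, by rw [Perm.inv_eq_iff_eq, h3], h4⟩
  have hne : ∀ {i' c : Fin n}, i'.val = i.val + 1 → i' < c → i' ≠ 0 ∧ i' ≠ topCity n := by
    intro i' c h1 h2
    refine ⟨fun h => ?_, fun h => ?_⟩
    · rw [h] at h1
      simp at h1
    · rw [h] at h2
      have := c.isLt
      simp only [topCity, Fin.lt_def] at h2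
      omega
  rcases hb with ⟨⟨h1, h2⟩ | ⟨h1, h2⟩, hsx, hsy⟩ |
    ⟨i', (⟨h1, h2⟩ | ⟨h1, h2⟩) | ⟨h1, h2, h3, h4⟩ | ⟨h1, h2, h3, h4⟩ | ⟨h1, h2, h3, h4⟩ |
      ⟨h1, h2, h3, h4⟩⟩
  · exact Or.inl ⟨(pass_up_of_not_inSB hx h0 htop h1 hsx).1.trans
      (pass_up_of_not_inSB hy h0 htop h2 hsy).2, h2⟩
  · exact Or.inr ⟨(pass_down_of_not_inSB hy h0 htop h2 hsy).1.trans
      (pass_down_of_not_inSB hx h0 htop h1 hsx).2, h1⟩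
  · refine Or.inl ⟨?_, h2.ascCity hy h0⟩
    rw [(hup h1).2.1]
    exact (hup h2).2.2
  · refine Or.inr ⟨?_, h1.not_ascCity hx h0⟩
    rw [h2.2.2.1]
    exact h1.2.1
  · refine Or.inl ⟨?_, h2⟩
    obtain ⟨h5, h6, h7⟩ := hup h1
    obtain ⟨h8, h9⟩ := pass_up_of_not_inSB hy h0 htop h2 h3
    rw [h6]
    refine lt_of_le_of_ne (by omega) fun heq => h3 ⟨i', ?_⟩
    have h10 : y⁻¹ i' = i := by rw [Perm.inv_eq_iff_eq, heq]
    have h11 := descSB_of_inv_apply_lt hy h4 (hne h5 h7).1 (hne h5 h7).2 (by rw [h10]; omega)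
    rw [h10] at h11
    exact Or.inr (Or.inr (Or.inl h11))
  · refine Or.inl ⟨?_, h1.ascCity hy h0⟩
    have h5 := (pass_up_of_not_inSB hx h0 htop h2 h3).1
    have h6 := hup h1
    omega
  · refine Or.inr ⟨?_, h1.not_ascCity hx h0⟩
    have h5 := (pass_down_of_not_inSB hy h0 htop h2 h3).1
    obtain ⟨h6, h7, -⟩ := h1
    omega
  · refine Or.inr ⟨?_, h2⟩
    obtain ⟨h5, h6, h7, -⟩ := h1
    obtain ⟨h8, h9⟩ := pass_down_of_not_inSB hx h0 htop h2 h3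
    rw [h7]
    refine lt_of_le_of_ne (by omega) fun heq => h3 ⟨i', ?_⟩
    have h10 : x i' = i := by rw [heq, perm_apply_inv_apply]
    have h11 := h4.ascSB_of_apply_lt hx (hne h5 h6).1 (hne h5 h6).2 (by rw [h10]; omega)
    rw [h10] at h11
    exact Or.inl h11

end Switching

end PSBPaper

open PSBPaper Equiv in
/-- Part 3 of the proof of Theorem 2, central part.
With `i` the smallest city where `z` switches from `x` to `y` and `j` the
smallest city where `z` switches from `y` to `x`, `2 ≤ i < j ≤ n − 1`
(city numbers are `·.val + 1`), let `ia` be the city number of the first city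
after the block at `i` (`i+1` for a single block, `i+2` for a double block at
`(i, i+1)`) and `jb` that of the last city before the block at `j` (`j−1` for
a single block, `j−2` for a double block at `(j−1, j)`). Then the direction
bits of `x` and `y` coincide on the central part `[ia, jb]`. -/
theorem central_direction_bits_coincide (n : ℕ)
    (x y z : Equiv.Perm (Fin (n + 4)))
    (hx : IsPSBT x) (hy : IsPSBT y) (hxy : x ≠ y)
    (hnadj : Nonadjacent x y)
    (hz : IsPSBT z) (hzx : z ≠ x) (hzy : z ≠ y)
    (harcs : ∀ k, z k = x k ∨ z k = y k)
    (hwit : PositiveWitness x y z)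
    (i j : Fin (n + 4))
    (hi : SwitchXtoY x y z i) (himin : ∀ k, SwitchXtoY x y z k → i ≤ k)
    (hj : SwitchYtoX x y z j) (hjmin : ∀ k, SwitchYtoX x y z k → j ≤ k)
    (hi2 : 2 ≤ i.val + 1) (hij : i < j) (hjn : j.val + 1 ≤ (n + 4) - 1)
    (ia jb : ℕ)
    (hia : (SingleU x y i ∧ ia = i.val + 2) ∨
      (∃ i' : Fin (n + 4), (DoubleU x y i i' ∨ LBlock x y i i') ∧
        ia = i.val + 3))
    (hjb : (SingleU x y j ∧ jb = j.val) ∨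
      (∃ j' : Fin (n + 4), (DoubleU x y j' j ∨ RBlock x y j' j) ∧
        jb = j.val - 1)) :
    ∀ k : Fin (n + 4), ia ≤ k.val + 1 → k.val + 1 ≤ jb →
      (AscCity x k ↔ AscCity y k) := by
  intro k hk1 hk2
  have hik : i < k := by omega
  have hkj : k < j := by omega
  have hjtop : j < topCity (n + 4) := by
    simp only [topCity, Fin.lt_def]
    omega
  have hi0 : 0 < i := by
    simp only [Fin.lt_def, Fin.val_zero]
    omega
  have hitop : i < topCity (n + 4) := hij.trans hjtop
  obtain ⟨hiin, hiout, -⟩ := hi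
  obtain ⟨hjin, hjout, -⟩ := hj
  have hnsw : ∀ c < j, ¬SwitchYtoX x y z c := fun c hc hs => absurd (hjmin c hs) (not_le.2 hc)
  have hpi : i.val + 1 = k.val → Passes x i ∧ Passes y i ∧ Passes z i := by
    intro h
    have hu : SingleU x y i := hia.elim And.left fun ⟨_, _, h'⟩ => by omega
    exact hu.passes hx hy hi0.ne' hitop.ne hiin hiout
  have hpj : k.val + 1 = j.val → Passes y j ∧ Passes x j ∧ Passes z j := by
    intro h
    have hu : SingleU x y j := hjb.elim And.left fun ⟨_, _, h'⟩ => by omega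
    exact hu.symm.passes hy hx (hi0.trans hij).ne' hjtop.ne hjin hjout
  have hdir := direction_of_left_block hx hy hz hi0.ne' hitop.ne hiin hiout
    (hia.imp And.left fun ⟨i', h, _⟩ => ⟨i', h⟩)
  rcases hdir with ⟨hzi, hyi⟩ | ⟨hzi, hxi⟩
  · exact central_direction_of_ascending_switch hx hy hz harcs hnsw hiin hiout hi0 hik hkj hjtop
      hzi hyi (fun h => (hpi h).2.1) (fun h => (hpi h).2.2) (fun h => (hpj h).2.1)
      (fun h => (hpj h).1) (fun h => (hpj h).2.2)
  · have harcs' : ∀ c, z⁻¹ c = y⁻¹ c ∨ z⁻¹ c = x⁻¹ c := by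
      intro c
      have h := harcs (z⁻¹ c)
      rw [perm_apply_inv_apply] at h
      rw [Perm.eq_inv_iff_eq, Perm.eq_inv_iff_eq, eq_comm, or_comm, eq_comm (b := c)]
      exact h
    have hiff := central_direction_of_ascending_switch hy.inv hx.inv hz.inv harcs'
      (fun c hc hs => hnsw c hc (switchYtoX_inv_iff.1 hs))
      (by rw [inv_inv, Perm.inv_eq_iff_eq, hiout])
      (by rw [Perm.inv_eq_iff_eq, hiin]) hi0 hik hkj hjtop
      ((ascCity_inv_iff hz hi0.ne' hitop.ne).2 hzi) ((ascCity_inv_iff hx hi0.ne' hitop.ne).2 hxi)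
      (fun h => passes_inv_iff.2 (hpi h).1) (fun h => passes_inv_iff.2 (hpi h).2.2)
      (fun h => passes_inv_iff.2 (hpj h).1) (fun h => passes_inv_iff.2 (hpj h).2.1)
      (fun h => passes_inv_iff.2 (hpj h).2.2)
    have hk0 : k ≠ 0 := (hi0.trans hik).ne'
    have hktop : k ≠ topCity (n + 4) := (hkj.trans hjtop).ne
    rw [ascCity_inv_iff hy hk0 hktop, ascCity_inv_iff hx hk0 hktop] at hiff
    exact (not_iff_not.1 hiff).symm
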